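/- For every positive integer m and every integer n ≥ m^m, the choice number of the complete bipartite graph K_{m,n} satisfies ch(K_{m,n}) = m + 1; in particular K_{m,m^m} is not m-choosable. -/

import Mathlib

/-- A graph `G` is `k`-choosable if for every assignment of lists of `k` colors
to the vertices there is a proper coloring choosing each vertex's color from its list. -/
def Choosable {V : Type*} (G : SimpleGraph V) (k : ℕ) : Prop :=
  ∀ L : V → Finset ℕ, (∀ v, (L v).card = k) →
    ∃ c : V → ℕ, (∀ v, c v ∈ L v) ∧ ∀ u w, G.Adj u w → c u ≠ c w

/-- The choice number of `G` is the least `k` such that `G` is `k`-choosable. -/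
noncomputable def choiceNumber {V : Type*} (G : SimpleGraph V) : ℕ :=
  sInf {k | Choosable G k}

/-- `nm m` is the smallest integer `n` such that `ch (K_{m,n}) = m - 1`. -/
noncomputable def nm (m : ℕ) : ℕ :=
  sInf {n | choiceNumber (completeBipartiteGraph (Fin m) (Fin n)) = m - 1}


/-- Choosability is monotone in the size of the lists. -/
theorem Choosable.mono {V : Type*} {G : SimpleGraph V} {k l : ℕ} (hkl : k ≤ l)
    (h : Choosable G k) : Choosable G l := by
  intro L hL
  choose L' hsub hcard using fun v => Finset.exists_subset_card_eq (hkl.trans_eq (hL v).symm)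
  obtain ⟨c, hc, hadj⟩ := h L' hcard
  exact ⟨c, fun v => hsub v (hc v), hadj⟩

/-- A complete bipartite graph is choosable from lists larger than its left part. -/
theorem choosable_completeBipartiteGraph_card_add_one (α β : Type*) [Fintype α] :
    Choosable (completeBipartiteGraph α β) (Fintype.card α + 1) := by
  intro L hL
  have hne (v : α ⊕ β) : (L v).Nonempty := Finset.card_pos.mp (by rw [hL]; omega)
  choose a ha using fun i : α => hne (.inl i)
  have hex (w : β) : ∃ x ∈ L (.inr w), x ∉ Finset.univ.image a := by
    apply Finset.exists_mem_notMem_of_card_lt_card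
    rw [hL]
    exact Nat.lt_succ_of_le Finset.card_image_le
  choose b hb hba using hex
  have hab (i : α) (w : β) : a i ≠ b w := fun h =>
    hba w (h ▸ Finset.mem_image_of_mem a (Finset.mem_univ i))
  refine ⟨Sum.elim a b, ?_, ?_⟩
  · rintro (i | w)
    · exact ha i
    · exact hb w
  · rintro (i | w) (j | x) hadj
    · simp at hadj
    · exact hab i x
    · exact (hab j w).symm
    · simp at hadj

/-- If the right part has at least `m ^ m` vertices, then `K_{m,n}` is not `m`-choosable: give the
left vertices disjoint lists and let the right lists exhaust all transversals of these. -/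
theorem not_choosable_completeBipartiteGraph {m n : ℕ} (hm : 0 < m) (hn : m ^ m ≤ n) :
    ¬ Choosable (completeBipartiteGraph (Fin m) (Fin n)) m := by
  intro h
  have : Nonempty (Fin m) := ⟨⟨0, hm⟩⟩
  obtain ⟨e⟩ : Nonempty ((Fin m → Fin m) ↪ Fin n) :=
    Function.Embedding.nonempty_of_card_le (by simpa using hn)
  obtain ⟨g, hg⟩ : ∃ g : Fin n → Fin m → Fin m, Function.Surjective g :=
    ⟨_, Function.invFun_surjective e.injective⟩
  obtain ⟨c, hc, hadj⟩ := h
    (Sum.elim (fun i => Finset.univ.image fun j : Fin m => Nat.pair i j)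
      (fun w => Finset.univ.image fun i : Fin m => Nat.pair i (g w i))) (by
    rintro (i | w)
    · rw [Sum.elim_inl, Finset.card_image_of_injective, Finset.card_fin]
      intro j k hjk
      exact Fin.ext (Nat.pair_eq_pair.mp hjk).2
    · rw [Sum.elim_inr, Finset.card_image_of_injective, Finset.card_fin]
      intro j k hjk
      exact Fin.ext (Nat.pair_eq_pair.mp hjk).1)
  have hleft (i : Fin m) : ∃ j : Fin m, Nat.pair i j = c (.inl i) := by simpa using hc (.inl i)
  choose f hf using hleft
  obtain ⟨w, rfl⟩ := hg f
  obtain ⟨i, hi⟩ : ∃ i : Fin m, Nat.pair i (g w i) = c (.inr w) := by simpa using hc (.inr w)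
  exact hadj (.inl i) (.inr w) (by simp) ((hf i).symm.trans hi)

/-- For every positive integer `m` and every `n ≥ m^m`, `ch (K_{m,n}) = m + 1`;
in particular `K_{m,m^m}` is not `m`-choosable. -/
theorem choiceNumber_completeBipartite_eq (m n : ℕ) (hm : 0 < m) (hn : m ^ m ≤ n) :
    choiceNumber (completeBipartiteGraph (Fin m) (Fin n)) = m + 1 ∧
      ¬ Choosable (completeBipartiteGraph (Fin m) (Fin (m ^ m))) m := by
  refine ⟨?_, not_choosable_completeBipartiteGraph hm le_rfl⟩
  have hmem : Choosable (completeBipartiteGraph (Fin m) (Fin n)) (m + 1) := by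
    simpa using choosable_completeBipartiteGraph_card_add_one (Fin m) (Fin n)
  refine le_antisymm (Nat.sInf_le hmem) (le_csInf ⟨_, hmem⟩ fun k hk => ?_)
  by_contra! hlt
  exact not_choosable_completeBipartiteGraph hm hn (Choosable.mono (Nat.le_of_lt_succ hlt) hk)
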